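/- Let C and D be preorders equipped with coverages J and K respectively, and let f : C → D be a flat cover-preserving monotone map. Then the map A_f : Id_J(C) → Id_K(D) sending a J-ideal I to the smallest K-ideal containing f(I) is a frame homomorphism (preserves the top element, binary meets, and arbitrary joins). -/

import Mathlib

/-- A `J`-ideal on a preorder `C` equipped with a coverage `J`. -/
def IsJIdeal {C : Type*} [Preorder C] (J : C → Set (Set C)) (I : Set C) : Prop :=
  (∀ a ∈ I, ∀ b, b ≤ a → b ∈ I) ∧
  ∀ c, ∀ S ∈ J c, (∀ d ∈ S, d ∈ I) → c ∈ I

/-- The `J`-closure of a subset: the smallest `J`-ideal containing it. -/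
def JClosure {C : Type*} [Preorder C] (J : C → Set (Set C)) (X : Set C) : Set C :=
  ⋂₀ {I | IsJIdeal J I ∧ X ⊆ I}

theorem isJIdeal_JClosure {C : Type*} [Preorder C] (J : C → Set (Set C)) (X : Set C) :
    IsJIdeal J (JClosure J X) := by
  refine ⟨fun a ha b hb I hI => hI.1.1 a (ha I hI) b hb, fun c S hS h I hI => ?_⟩
  exact hI.1.2 c S hS fun d hd => h d hd I hI

theorem subset_JClosure {C : Type*} [Preorder C] (J : C → Set (Set C)) (X : Set C) :
    X ⊆ JClosure J X :=
  fun _ hx _ hI => hI.2 hx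

theorem JClosure_subset {C : Type*} [Preorder C] {J : C → Set (Set C)} {X I : Set C}
    (hI : IsJIdeal J I) (h : X ⊆ I) : JClosure J X ⊆ I :=
  fun _ hx => hx I ⟨hI, h⟩

theorem JClosure_mono {C : Type*} [Preorder C] (J : C → Set (Set C)) {X Y : Set C}
    (h : X ⊆ Y) : JClosure J X ⊆ JClosure J Y :=
  JClosure_subset (isJIdeal_JClosure J Y) (h.trans (subset_JClosure J Y))

/-- The Heyting implication from a down-set to a `J`-ideal is a `J`-ideal. -/
theorem IsJIdeal.himp {C : Type*} [Preorder C] {J : C → Set (Set C)}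
    (hstab : ∀ c, ∀ S ∈ J c, ∀ c', c' ≤ c → {d | d ∈ S ∧ d ≤ c'} ∈ J c')
    {A L : Set C} (hA : ∀ a ∈ A, ∀ b, b ≤ a → b ∈ A) (hL : IsJIdeal J L) :
    IsJIdeal J {d | ∀ e, e ≤ d → e ∈ A → e ∈ L} := by
  refine ⟨fun a ha b hb e he => ha e (he.trans hb), fun c S hS h e he heA => ?_⟩
  exact hL.2 e _ (hstab c S hS e he) fun d hd => h d hd.1 d le_rfl (hA e heA d hd.2)

/-- The preimage of an ideal under a cover-preserving monotone map is an ideal. -/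
theorem IsJIdeal.preimage {C D : Type*} [Preorder C] [Preorder D]
    {J : C → Set (Set C)} {K : D → Set (Set D)} {f : C → D} (hmono : Monotone f)
    (hcover : ∀ c, ∀ R ∈ J c, ∃ T ∈ K (f c), ∀ d ∈ T, ∃ c' ∈ R, d ≤ f c')
    {M : Set D} (hM : IsJIdeal K M) : IsJIdeal J (f ⁻¹' M) := by
  refine ⟨fun a ha b hb => hM.1 _ ha _ (hmono hb), fun c R hR h => ?_⟩
  obtain ⟨T, hT, hTR⟩ := hcover c R hR
  refine hM.2 _ T hT fun d hd => ?_
  obtain ⟨c', hc', hdc'⟩ := hTR d hd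
  exact hM.1 _ (h c' hc') d hdc'

/-- Let `C`, `D` be preorders with coverages `J`, `K` and `f : C → D` a flat
cover-preserving monotone map. Then `A_f : Id_J(C) → Id_K(D)`, sending a `J`-ideal
`I` to the smallest `K`-ideal containing `f '' I`, is a frame homomorphism: it
preserves the top element, binary meets, and arbitrary joins. -/
theorem statement_12 {C D : Type*} [Preorder C] [Preorder D]
    (J : C → Set (Set C)) (K : D → Set (Set D))
    (hJsub : ∀ c, ∀ S ∈ J c, ∀ d ∈ S, d ≤ c)
    (hJstab : ∀ c, ∀ S ∈ J c, ∀ c', c' ≤ c → {d | d ∈ S ∧ d ≤ c'} ∈ J c')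
    (hKsub : ∀ c, ∀ S ∈ K c, ∀ d ∈ S, d ≤ c)
    (hKstab : ∀ c, ∀ S ∈ K c, ∀ c', c' ≤ c → {d | d ∈ S ∧ d ≤ c'} ∈ K c')
    (f : C → D) (hmono : Monotone f)
    (hflat1 : ∀ d : D, ∃ c : C, d ≤ f c)
    (hflat2 : ∀ d : D, ∀ c c' : C, d ≤ f c → d ≤ f c' →
      ∃ c'' : C, c'' ≤ c ∧ c'' ≤ c' ∧ d ≤ f c'')
    (hcover : ∀ c, ∀ R ∈ J c, ∃ T ∈ K (f c), ∀ d ∈ T, ∃ c' ∈ R, d ≤ f c') :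
    -- preserves the top element
    JClosure K (f '' Set.univ) = Set.univ ∧
    -- preserves binary meets
    (∀ I₁ I₂, IsJIdeal J I₁ → IsJIdeal J I₂ →
      JClosure K (f '' (I₁ ∩ I₂)) = JClosure K (f '' I₁) ∩ JClosure K (f '' I₂)) ∧
    -- preserves arbitrary joins
    (∀ Ks : Set (Set C), (∀ I ∈ Ks, IsJIdeal J I) →
      JClosure K (f '' JClosure J (⋃₀ Ks)) =
        JClosure K (⋃₀ ((fun I => JClosure K (f '' I)) '' Ks))) := by
  refine ⟨?_, fun I₁ I₂ hI₁ hI₂ => ?_, fun Ks _ => ?_⟩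
  · refine Set.eq_univ_of_forall fun d => ?_
    obtain ⟨c, hc⟩ := hflat1 d
    exact (isJIdeal_JClosure K _).1 _
      (subset_JClosure K _ (Set.mem_image_of_mem f (Set.mem_univ c))) d hc
  · refine Set.Subset.antisymm
      (Set.subset_inter (JClosure_mono K (Set.image_mono Set.inter_subset_left))
        (JClosure_mono K (Set.image_mono Set.inter_subset_right))) ?_
    have hL := isJIdeal_JClosure K (f '' (I₁ ∩ I₂))
    have key : JClosure K (f '' I₁) ⊆
        {d | ∀ e, e ≤ d → e ∈ JClosure K (f '' I₂) → e ∈ JClosure K (f '' (I₁ ∩ I₂))} := by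
      refine JClosure_subset (hL.himp hKstab (isJIdeal_JClosure K _).1) ?_
      rintro _ ⟨c₁, hc₁, rfl⟩ e he he₂
      have key₂ : JClosure K (f '' I₂) ⊆
          {d | ∀ e, e ≤ d → e ∈ Set.Iic (f c₁) → e ∈ JClosure K (f '' (I₁ ∩ I₂))} := by
        refine JClosure_subset (hL.himp hKstab fun a ha b hb => hb.trans ha) ?_
        rintro _ ⟨c₂, hc₂, rfl⟩ e' h₂ h₁
        obtain ⟨c, hcc₁, hcc₂, hec⟩ := hflat2 e' c₁ c₂ h₁ h₂
        exact hL.1 _ (subset_JClosure K _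
          ⟨c, ⟨hI₁.1 c₁ hc₁ c hcc₁, hI₂.1 c₂ hc₂ c hcc₂⟩, rfl⟩) e' hec
      exact key₂ he₂ e le_rfl he
    exact fun d hd => key hd.1 d le_rfl hd.2
  · apply Set.Subset.antisymm
    · have hM := isJIdeal_JClosure K (⋃₀ ((fun I => JClosure K (f '' I)) '' Ks))
      refine JClosure_subset hM (Set.image_subset_iff.2
        (JClosure_subset (hM.preimage hmono hcover) ?_))
      rintro c ⟨I, hI, hc⟩
      exact subset_JClosure K _
        ⟨_, ⟨I, hI, rfl⟩, subset_JClosure K _ (Set.mem_image_of_mem f hc)⟩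
    · refine JClosure_subset (isJIdeal_JClosure K _) ?_
      rintro d ⟨_, ⟨I, hI, rfl⟩, hd⟩
      exact JClosure_mono K (Set.image_mono
        ((Set.subset_sUnion_of_mem hI).trans (subset_JClosure J _))) hd
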